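/- Let ⟨[0,1], ⊕_p⟩ and ⟨[0,1], ⊕'_p⟩ be convex algebras satisfying (MO), (UC) and (LC). Then the two algebras are isomorphic (i.e. there is a bijection Φ : [0,1] → [0,1] with Φ(x ⊕_p y) = Φ(x) ⊕'_p Φ(y) for all x, y and p ∈ (0,1)) if and only if: (i) there exists a strictly increasing bijection φ : E^⊕ → E^⊕′ such that τ^⊕_{a,b} = τ^⊕′_{φ(a),φ(b)} for all (a,b) ∈ Δ^⊕ (note that (φ×φ)(Δ^⊕) = Δ^⊕′); and (ii) max E^⊕ < 1 if and only if max E^⊕′ < 1. -/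

import Mathlib

open Set Filter Topology

/-- A convex algebra on the interval `[0,1] ⊆ ℝ`: `op p x y` denotes `x ⊕_p y`,
for `p ∈ (0,1)`, extended to `p ∈ [0,1]` by the projection axioms
`x ⊕_1 y = x` and `x ⊕_0 y = y`.  All axioms are required only on `[0,1]`;
values of `op` outside `[0,1]` are irrelevant. -/
structure UCA where
  op : ℝ → ℝ → ℝ → ℝ
  mem : ∀ p ∈ Set.Icc (0:ℝ) 1, ∀ x ∈ Set.Icc (0:ℝ) 1, ∀ y ∈ Set.Icc (0:ℝ) 1,
      op p x y ∈ Set.Icc (0:ℝ) 1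
  idem : ∀ p ∈ Set.Ioo (0:ℝ) 1, ∀ x ∈ Set.Icc (0:ℝ) 1, op p x x = x
  comm : ∀ p ∈ Set.Ioo (0:ℝ) 1, ∀ x ∈ Set.Icc (0:ℝ) 1, ∀ y ∈ Set.Icc (0:ℝ) 1,
      op p x y = op (1 - p) y x
  assoc : ∀ p ∈ Set.Ioo (0:ℝ) 1, ∀ q ∈ Set.Ioo (0:ℝ) 1,
      ∀ x ∈ Set.Icc (0:ℝ) 1, ∀ y ∈ Set.Icc (0:ℝ) 1, ∀ z ∈ Set.Icc (0:ℝ) 1,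
      op q (op p x y) z = op (p * q) x (op ((1 - p) * q / (1 - p * q)) y z)
  proj1 : ∀ x ∈ Set.Icc (0:ℝ) 1, ∀ y ∈ Set.Icc (0:ℝ) 1, op 1 x y = x
  proj0 : ∀ x ∈ Set.Icc (0:ℝ) 1, ∀ y ∈ Set.Icc (0:ℝ) 1, op 0 x y = y

/-- Monotonicity (MO): `x ≤ x'` implies `x ⊕_p y ≤ x' ⊕_p y`. -/
def UCA.MO (A : UCA) : Prop :=
  ∀ x ∈ Set.Icc (0:ℝ) 1, ∀ x' ∈ Set.Icc (0:ℝ) 1, ∀ y ∈ Set.Icc (0:ℝ) 1,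
    ∀ p ∈ Set.Ioo (0:ℝ) 1, x ≤ x' → A.op p x y ≤ A.op p x' y

/-- (UC): for `x, y ∈ [0,1)` and `p ∈ (0,1)`,
`limsup_{ε→0⁺} ((x+ε) ⊕_p (y+ε)) ≤ x ⊕_p y`. -/
def UCA.UC (A : UCA) : Prop :=
  ∀ x ∈ Set.Ico (0:ℝ) 1, ∀ y ∈ Set.Ico (0:ℝ) 1, ∀ p ∈ Set.Ioo (0:ℝ) 1,
    Filter.limsup (fun ε => A.op p (x + ε) (y + ε)) (𝓝[>] (0:ℝ)) ≤ A.op p x y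

/-- (LC): for `x ≤ y` in `[0,1]`, `liminf_{p→1⁻} (y ⊕_p x) ≥ y`. -/
def UCA.LC (A : UCA) : Prop :=
  ∀ x ∈ Set.Icc (0:ℝ) 1, ∀ y ∈ Set.Icc (0:ℝ) 1, x ≤ y →
    y ≤ Filter.liminf (fun p => A.op p y x) (𝓝[<] (1:ℝ))

/-- `y ⊳ x` : `y` eats `x`, i.e. `y ⊕_t x = y` for all `t ∈ (0,1]`. -/
def UCA.Eats (A : UCA) (y x : ℝ) : Prop :=
  ∀ t ∈ Set.Ioc (0:ℝ) 1, A.op t y x = y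

/-- `E^⊕ = { y ∈ [0,1] : y ⊳ 0 }`. -/
def UCA.E (A : UCA) : Set ℝ := {y ∈ Set.Icc (0:ℝ) 1 | A.Eats y 0}

/-- `V_{x,y} = inf { y ⊕_p x : p ∈ (0,1] }`. -/
noncomputable def UCA.V (A : UCA) (x y : ℝ) : ℝ :=
  sInf ((fun p => A.op p y x) '' Set.Ioc (0:ℝ) 1)

/-- The interval `[0, τ)` for `τ ∈ {1, ∞}` (encoded in `ℝ≥0∞`):
`{t : ℝ | 0 ≤ t, t < τ}`. -/
def tauSet (τ : ENNReal) : Set ℝ := {t : ℝ | 0 ≤ t ∧ ENNReal.ofReal t < τ}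

/-- `Φ` is an isomorphism of `⟨[0,τ), +_p⟩` (operations induced by linear combinations)
onto `⟨[a,b), ⊕_p⟩`: a bijection of `[0,τ)` onto `[a,b)` with
`Φ(s +_p t) = Φ(s) ⊕_p Φ(t)`. -/
def UCA.IsTauIso (A : UCA) (a b : ℝ) (τ : ENNReal) (Φ : ℝ → ℝ) : Prop :=
  Set.BijOn Φ (tauSet τ) (Set.Ico a b) ∧
  ∀ p ∈ Set.Ioo (0:ℝ) 1, ∀ s ∈ tauSet τ, ∀ t ∈ tauSet τ,
    Φ (p * s + (1 - p) * t) = A.op p (Φ s) (Φ t)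

/-- `(a,b) ∈ Δ^⊕`: `a, b ∈ E^⊕`, `a < b`, and `(a,b) ∩ E^⊕ = ∅`. -/
def UCA.Delta (A : UCA) (a b : ℝ) : Prop :=
  a ∈ A.E ∧ b ∈ A.E ∧ a < b ∧ Set.Ioo a b ∩ A.E = ∅

namespace UCA

variable {A : UCA}

lemma commI (A : UCA) {p x y : ℝ} (hp : p ∈ Icc (0:ℝ) 1) (hx : x ∈ Icc (0:ℝ) 1)
    (hy : y ∈ Icc (0:ℝ) 1) : A.op p x y = A.op (1 - p) y x := by
  rcases eq_or_lt_of_le hp.1 with h | h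
  · subst h; simp [A.proj0 x hx y hy, A.proj1 y hy x hx]
  rcases eq_or_lt_of_le hp.2 with h' | h'
  · subst h'; simp [A.proj1 x hx y hy, A.proj0 y hy x hx]
  exact A.comm p ⟨h, h'⟩ x hx y hy

lemma idemI (A : UCA) {p x : ℝ} (hp : p ∈ Icc (0:ℝ) 1) (hx : x ∈ Icc (0:ℝ) 1) :
    A.op p x x = x := by
  rcases eq_or_lt_of_le hp.1 with h | h
  · subst h; exact A.proj0 x hx x hx
  rcases eq_or_lt_of_le hp.2 with h' | h'
  · subst h'; exact A.proj1 x hx x hx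
  exact A.idem p ⟨h, h'⟩ x hx

lemma one_sub_mem {p : ℝ} (hp : p ∈ Icc (0:ℝ) 1) : 1 - p ∈ Icc (0:ℝ) 1 :=
  ⟨by linarith [hp.2], by linarith [hp.1]⟩

lemma moI (hMO : A.MO) {p x x' y : ℝ} (hp : p ∈ Icc (0:ℝ) 1) (hx : x ∈ Icc (0:ℝ) 1)
    (hx' : x' ∈ Icc (0:ℝ) 1) (hy : y ∈ Icc (0:ℝ) 1) (h : x ≤ x') :
    A.op p x y ≤ A.op p x' y := by
  rcases eq_or_lt_of_le hp.1 with h0 | h0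
  · subst h0; rw [A.proj0 x hx y hy, A.proj0 x' hx' y hy]
  rcases eq_or_lt_of_le hp.2 with h1 | h1
  · subst h1; rwa [A.proj1 x hx y hy, A.proj1 x' hx' y hy]
  exact hMO x hx x' hx' y hy p ⟨h0, h1⟩ h

lemma mo2 (hMO : A.MO) {p x x' y y' : ℝ} (hp : p ∈ Icc (0:ℝ) 1) (hx : x ∈ Icc (0:ℝ) 1)
    (hx' : x' ∈ Icc (0:ℝ) 1) (hy : y ∈ Icc (0:ℝ) 1) (hy' : y' ∈ Icc (0:ℝ) 1)
    (h : x ≤ x') (h' : y ≤ y') : A.op p x y ≤ A.op p x' y' := by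
  refine (moI hMO hp hx hx' hy h).trans ?_
  rw [A.commI hp hx' hy, A.commI hp hx' hy']
  exact moI hMO (one_sub_mem hp) hy hy' hx' h'

lemma op_le (hMO : A.MO) {p x y c : ℝ} (hp : p ∈ Icc (0:ℝ) 1) (hx : x ∈ Icc (0:ℝ) 1)
    (hy : y ∈ Icc (0:ℝ) 1) (hc : c ∈ Icc (0:ℝ) 1) (h : x ≤ c) (h' : y ≤ c) :
    A.op p x y ≤ c := by
  have := mo2 hMO hp hx hc hy hc h h'
  rwa [A.idemI hp hc] at this

lemma le_op (hMO : A.MO) {p x y c : ℝ} (hp : p ∈ Icc (0:ℝ) 1) (hx : x ∈ Icc (0:ℝ) 1)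
    (hy : y ∈ Icc (0:ℝ) 1) (hc : c ∈ Icc (0:ℝ) 1) (h : c ≤ x) (h' : c ≤ y) :
    c ≤ A.op p x y := by
  have := mo2 hMO hp hc hx hc hy h h'
  rwa [A.idemI hp hc] at this

lemma contract (A : UCA) {s t x y : ℝ} (hs : s ∈ Icc (0:ℝ) 1) (ht : t ∈ Icc (0:ℝ) 1)
    (hx : x ∈ Icc (0:ℝ) 1) (hy : y ∈ Icc (0:ℝ) 1) :
    A.op s (A.op t y x) x = A.op (t * s) y x := by
  rcases eq_or_lt_of_le hs.1 with h0 | h0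
  · subst h0
    rw [mul_zero, A.proj0 y hy x hx, A.proj0 _ (A.mem t ht y hy x hx) x hx]
  rcases eq_or_lt_of_le hs.2 with h1 | h1
  · subst h1
    rw [mul_one, A.proj1 _ (A.mem t ht y hy x hx) x hx]
  rcases eq_or_lt_of_le ht.1 with h2 | h2
  · subst h2
    rw [zero_mul, A.proj0 y hy x hx, A.idemI hs hx]
  rcases eq_or_lt_of_le ht.2 with h3 | h3
  · subst h3
    rw [one_mul, A.proj1 y hy x hx]
  rw [A.assoc t ⟨h2, h3⟩ s ⟨h0, h1⟩ y hy x hx x hx]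
  have hts : t * s < 1 := by nlinarith
  rw [A.idem _ ⟨?_, ?_⟩ x hx]
  · exact div_pos (mul_pos (by linarith) h0) (by linarith)
  · rw [div_lt_one (by linarith)]; nlinarith

lemma expand (A : UCA) {r s x y : ℝ} (hr : r ∈ Icc (0:ℝ) 1) (hs : s ∈ Icc (0:ℝ) 1)
    (hx : x ∈ Icc (0:ℝ) 1) (hy : y ∈ Icc (0:ℝ) 1) :
    A.op r y (A.op s y x) = A.op (1 - (1 - s) * (1 - r)) y x := by
  have hr' := one_sub_mem hr
  have hs' := one_sub_mem hs
  rw [A.commI hr hy (A.mem s hs y hy x hx), A.commI hs hy hx, A.contract hr' hs' hy hx,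
    A.commI _ hx hy]
  exact ⟨mul_nonneg hs'.1 hr'.1, mul_le_one₀ hs'.2 hr'.1 hr'.2⟩

lemma comb_mem {r p q : ℝ} (hr : r ∈ Icc (0:ℝ) 1) (hp : p ∈ Icc (0:ℝ) 1)
    (hq : q ∈ Icc (0:ℝ) 1) : r * p + (1 - r) * q ∈ Icc (0:ℝ) 1 := by
  obtain ⟨a, b⟩ := hr; obtain ⟨c, d⟩ := hp; obtain ⟨e, f⟩ := hq
  constructor <;> nlinarith

lemma seg_aux (A : UCA) {r p q x y : ℝ} (hr : r ∈ Icc (0:ℝ) 1) (hp : p ∈ Icc (0:ℝ) 1)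
    (hq : q ∈ Icc (0:ℝ) 1) (hx : x ∈ Icc (0:ℝ) 1) (hy : y ∈ Icc (0:ℝ) 1) (hqp : q ≤ p) :
    A.op r (A.op p y x) (A.op q y x) = A.op (r * p + (1 - r) * q) y x := by
  rcases eq_or_lt_of_le hp.1 with h0 | h0
  · have : q = 0 := le_antisymm (by linarith) hq.1
    subst this; subst h0
    rw [A.idemI hr (A.mem _ hp _ hy _ hx)]; simp
  · have hs : q / p ∈ Icc (0:ℝ) 1 := ⟨div_nonneg hq.1 h0.le, by rw [div_le_one h0]; exact hqp⟩
    have e : A.op q y x = A.op (q / p) (A.op p y x) x := by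
      rw [A.contract hs hp hx hy]; congr 1; field_simp
    have hm : 1 - (1 - q / p) * (1 - r) ∈ Icc (0:ℝ) 1 := by
      have hr' := one_sub_mem hr
      have hs' := one_sub_mem hs
      exact one_sub_mem ⟨mul_nonneg hs'.1 hr'.1, mul_le_one₀ hs'.2 hr'.1 hr'.2⟩
    rw [e, A.expand hr hs hx (A.mem _ hp _ hy _ hx), A.contract hm hp hx hy]
    congr 1; field_simp; ring

lemma seg (A : UCA) {r p q x y : ℝ} (hr : r ∈ Icc (0:ℝ) 1) (hp : p ∈ Icc (0:ℝ) 1)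
    (hq : q ∈ Icc (0:ℝ) 1) (hx : x ∈ Icc (0:ℝ) 1) (hy : y ∈ Icc (0:ℝ) 1) :
    A.op r (A.op p y x) (A.op q y x) = A.op (r * p + (1 - r) * q) y x := by
  rcases le_total q p with h | h
  · exact A.seg_aux hr hp hq hx hy h
  · rw [A.commI hr (A.mem _ hp _ hy _ hx) (A.mem _ hq _ hy _ hx),
      A.seg_aux (one_sub_mem hr) hq hp hx hy h]
    congr 1; ring

lemma seg_mono (hMO : A.MO) {p q x y : ℝ} (hp : p ∈ Icc (0:ℝ) 1)
    (hq : q ∈ Icc (0:ℝ) 1) (hx : x ∈ Icc (0:ℝ) 1) (hy : y ∈ Icc (0:ℝ) 1) (hxy : x ≤ y)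
    (hqp : q ≤ p) : A.op q y x ≤ A.op p y x := by
  rcases eq_or_lt_of_le hp.1 with h0 | h0
  · have : q = 0 := le_antisymm (by linarith) hq.1
    subst this; subst h0; rfl
  · have hs : q / p ∈ Icc (0:ℝ) 1 := ⟨div_nonneg hq.1 h0.le, by rw [div_le_one h0]; exact hqp⟩
    have e : A.op q y x = A.op (q / p) (A.op p y x) x := by
      rw [A.contract hs hp hx hy]; congr 1; field_simp
    have hm := A.mem p hp y hy x hx
    rw [e]
    exact op_le hMO hs hm hx hm le_rfl (le_op hMO hp hy hx hx hxy le_rfl)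

lemma lc' (hLC : A.LC) {x y c : ℝ} (hx : x ∈ Icc (0:ℝ) 1) (hy : y ∈ Icc (0:ℝ) 1) (hxy : x ≤ y)
    (h : ∀ r ∈ Ioo (0:ℝ) 1, A.op r y x ≤ c) : y ≤ c := by
  refine (hLC x hx y hy hxy).trans ?_
  have hev : ∀ᶠ r in 𝓝[<] (1:ℝ), r ∈ Ioo (0:ℝ) 1 := Ioo_mem_nhdsLT one_pos
  apply Filter.liminf_le_of_frequently_le
  · exact (hev.mono fun r hr => h r hr).frequently
  · refine ⟨0, ?_⟩
    rw [eventually_map]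
    exact hev.mono fun r hr => (A.mem r ⟨hr.1.le, hr.2.le⟩ y hy x hx).1

lemma uc' (hUC : A.UC) {x y c p : ℝ} (hx : x ∈ Ico (0:ℝ) 1) (hy : y ∈ Ico (0:ℝ) 1)
    (hp : p ∈ Ioo (0:ℝ) 1)
    (h : ∀ ε > 0, x + ε ≤ 1 → y + ε ≤ 1 → c ≤ A.op p (x + ε) (y + ε)) : c ≤ A.op p x y := by
  refine le_trans ?_ (hUC x hx y hy p hp)
  have hev : ∀ᶠ ε in 𝓝[>] (0:ℝ), ε ∈ Ioo (0:ℝ) (min (1 - x) (1 - y)) :=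
    Ioo_mem_nhdsGT (lt_min (by linarith [hx.2]) (by linarith [hy.2]))
  have hb : ∀ ε ∈ Ioo (0:ℝ) (min (1 - x) (1 - y)), x + ε ≤ 1 ∧ y + ε ≤ 1 := fun ε hε =>
    ⟨by linarith [lt_min_iff.1 hε.2 |>.1], by linarith [lt_min_iff.1 hε.2 |>.2]⟩
  apply Filter.le_limsup_of_frequently_le
  · exact (hev.mono fun ε hε => h ε hε.1 (hb ε hε).1 (hb ε hε).2).frequently
  · refine ⟨1, ?_⟩
    rw [eventually_map]
    exact hev.mono fun ε hε => (A.mem p ⟨hp.1.le, hp.2.le⟩ _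
      ⟨by linarith [hx.1, hε.1], (hb ε hε).1⟩ _ ⟨by linarith [hy.1, hε.1], (hb ε hε).2⟩).2

lemma zero_mem : (0:ℝ) ∈ Icc (0:ℝ) 1 := ⟨le_rfl, zero_le_one⟩
lemma one_mem : (1:ℝ) ∈ Icc (0:ℝ) 1 := ⟨zero_le_one, le_rfl⟩

lemma zero_E (A : UCA) : (0:ℝ) ∈ A.E :=
  ⟨zero_mem, fun _ ht => A.idemI ⟨ht.1.le, ht.2⟩ zero_mem⟩

/-- membership in E from a lower bound -/
lemma mem_E (hMO : A.MO) {y : ℝ} (hy : y ∈ Icc (0:ℝ) 1)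
    (h : ∀ t ∈ Ioo (0:ℝ) 1, y ≤ A.op t y 0) : y ∈ A.E := by
  refine ⟨hy, fun t ht => ?_⟩
  rcases eq_or_lt_of_le ht.2 with h1 | h1
  · subst h1; exact A.proj1 y hy 0 zero_mem
  · exact le_antisymm (op_le hMO ⟨ht.1.le, ht.2⟩ hy zero_mem hy le_rfl hy.1) (h t ⟨ht.1, h1⟩)

lemma E_eats (hMO : A.MO) {b x : ℝ} (hb : b ∈ A.E) (hx : x ∈ Icc (0:ℝ) 1) (hxb : x ≤ b) :
    A.Eats b x := by
  intro t ht
  have ht' : t ∈ Icc (0:ℝ) 1 := ⟨ht.1.le, ht.2⟩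
  refine le_antisymm (op_le hMO ht' hb.1 hx hb.1 le_rfl hxb) ?_
  have := mo2 hMO ht' hb.1 hb.1 zero_mem hx le_rfl hx.1
  rwa [hb.2 t ht] at this

lemma key (hMO : A.MO) (hLC : A.LC) {b x y p : ℝ} (hb : b ∈ A.E) (hx : x ∈ Icc (0:ℝ) 1)
    (hy : y ∈ Icc (0:ℝ) 1) (hxb : x ≤ b) (hby : b ≤ y) (hp : p ∈ Ioo (0:ℝ) 1) :
    A.op p y x = A.op p y b := by
  have hp' : p ∈ Icc (0:ℝ) 1 := ⟨hp.1.le, hp.2.le⟩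
  refine le_antisymm (mo2 hMO hp' hy hy hx hb.1 le_rfl hxb) ?_
  have hz := A.mem p hp' y hy x hx
  have hw := A.mem p hp' y hy b hb.1
  have hbz : b ≤ A.op p y x := by
    have := moI hMO hp' hb.1 hy hx hby
    rwa [E_eats hMO hb hx hxb p ⟨hp.1, hp.2.le⟩] at this
  refine lc' hLC hb.1 hw (le_op hMO hp' hy hb.1 hb.1 hby le_rfl) fun r hr => ?_
  have hr' : r ∈ Icc (0:ℝ) 1 := ⟨hr.1.le, hr.2.le⟩
  have h1 : A.op r (A.op p y x) b ≤ A.op p y x := op_le hMO hr' hz hb.1 hz le_rfl hbz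
  rw [A.assoc p hp r hr y hy x hx b hb.1] at h1
  have hpr : p * r < 1 := by nlinarith [hp.1, hp.2, hr.1, hr.2]
  set s := (1 - p) * r / (1 - p * r) with hs
  have hs0 : 0 < s := div_pos (mul_pos (by linarith [hp.2]) hr.1) (by linarith)
  have hs1 : s < 1 := by
    rw [hs, div_lt_one (by linarith)]; nlinarith [hp.1, hp.2, hr.1, hr.2]
  rw [A.comm s ⟨hs0, hs1⟩ x hx b hb.1,
    E_eats hMO hb hx hxb (1 - s) ⟨by linarith, by linarith⟩] at h1
  rwa [A.contract hr' hp' hb.1 hy]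

lemma exists_greatest (hMO : A.MO) {y : ℝ} (hy : y ∈ Icc (0:ℝ) 1) :
    ∃ a ∈ A.E, a ≤ y ∧ ∀ c ∈ A.E, c ≤ y → c ≤ a := by
  set S := {c | c ∈ A.E ∧ c ≤ y} with hS
  have hne : S.Nonempty := ⟨0, A.zero_E, hy.1⟩
  have hbd : BddAbove S := ⟨y, fun c hc => hc.2⟩
  have hle : sSup S ≤ y := csSup_le hne fun c hc => hc.2
  have hI : sSup S ∈ Icc (0:ℝ) 1 := ⟨le_csSup hbd ⟨A.zero_E, hy.1⟩, hle.trans hy.2⟩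
  refine ⟨sSup S, mem_E hMO hI fun t ht => ?_, hle, fun c hc hcy => le_csSup hbd ⟨hc, hcy⟩⟩
  refine csSup_le hne fun c hc => ?_
  have := moI hMO ⟨ht.1.le, ht.2.le⟩ hc.1.1 hI zero_mem (le_csSup hbd hc)
  rwa [hc.1.2 t ⟨ht.1, ht.2.le⟩] at this

lemma exists_least (hMO : A.MO) (hUC : A.UC) {y c : ℝ} (hc : c ∈ A.E) (hyc : y ≤ c) :
    ∃ b ∈ A.E, y ≤ b ∧ ∀ d ∈ A.E, y ≤ d → b ≤ d := by
  set S := {c | c ∈ A.E ∧ y ≤ c} with hS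
  have hne : S.Nonempty := ⟨c, hc, hyc⟩
  have hbd : BddBelow S := ⟨y, fun c hc => hc.2⟩
  have hle : y ≤ sInf S := le_csInf hne fun c hc => hc.2
  have hI : sInf S ∈ Icc (0:ℝ) 1 :=
    ⟨le_csInf hne fun d hd => hd.1.1.1, (csInf_le hbd ⟨hc, hyc⟩).trans hc.1.2⟩
  refine ⟨sInf S, ?_, hle, fun d hd hyd => csInf_le hbd ⟨hd, hyd⟩⟩
  rcases eq_or_lt_of_le hI.2 with h1 | h1
  · have : sInf S = c := le_antisymm (csInf_le hbd ⟨hc, hyc⟩) (h1 ▸ hc.1.2)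
    rw [this]; exact hc
  refine mem_E hMO hI fun t ht => uc' hUC ⟨hI.1, h1⟩ ⟨le_rfl, one_pos⟩ ht fun ε hε h2 h3 => ?_
  obtain ⟨d, hd, hdlt⟩ := exists_lt_of_csInf_lt hne (lt_add_of_pos_right (sInf S) hε)
  have := mo2 (A := A) hMO ⟨ht.1.le, ht.2.le⟩ hd.1.1 ⟨by linarith [hI.1], h2⟩ zero_mem
    (y' := 0 + ε) ⟨by linarith, h3⟩ hdlt.le (by linarith)
  rw [hd.1.2 t ⟨ht.1, ht.2.le⟩] at this
  exact (csInf_le hbd hd).trans this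

/-- The piece of the algebra starting at `a`. -/
def P (A : UCA) (a : ℝ) : Set ℝ :=
  {y | y ∈ Icc (0:ℝ) 1 ∧ a ≤ y ∧ ∀ c ∈ A.E, c ≤ y → c ≤ a}

/-- Linear coordinates on a piece. -/
def Coord (A : UCA) (a : ℝ) (S : Set ℝ) : Prop :=
  ∃ h : ℝ → ℝ, BijOn h S (A.P a) ∧ h 0 = a ∧ (0:ℝ) ∈ S ∧
    ∀ p ∈ Ioo (0:ℝ) 1, ∀ s ∈ S, ∀ t ∈ S,
      p * s + (1 - p) * t ∈ S ∧ h (p * s + (1 - p) * t) = A.op p (h s) (h t)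

lemma top_eat (hMO : A.MO) (hLC : A.LC) {e z : ℝ} (he : e ∈ A.E) (hmax : ∀ c ∈ A.E, c ≤ e)
    (hz : z ∈ Icc (0:ℝ) 1) (hez : e ≤ z) (h : ∀ t ∈ Ioo (0:ℝ) 1, z ≤ A.op t z e) : z = e := by
  refine le_antisymm (hmax z (mem_E hMO hz fun t ht => ?_)) hez
  rw [key hMO hLC he zero_mem hz he.1.1 hez ht]
  exact h t ht

lemma top_pos (hMO : A.MO) (hLC : A.LC) {e p : ℝ} (he : e ∈ A.E) (he1 : e < 1)
    (hp : p ∈ Ioc (0:ℝ) 1) : e < A.op p 1 e := by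
  rcases eq_or_lt_of_le hp.2 with h1 | h1
  · subst h1; rwa [A.proj1 1 one_mem e he.1]
  by_contra hcon
  have hp' : p ∈ Icc (0:ℝ) 1 := ⟨hp.1.le, hp.2⟩
  have hfe : A.op p 1 e = e :=
    le_antisymm (not_lt.1 hcon) (le_op hMO hp' one_mem he.1 he.1 he1.le le_rfl)
  have hn : ∀ n : ℕ, (1 - (1 - p) ^ n) ∈ Icc (0:ℝ) 1 := fun n =>
    one_sub_mem ⟨pow_nonneg (by linarith) n, pow_le_one₀ (by linarith) (by linarith [hp.1])⟩
  have hit : ∀ n : ℕ, A.op (1 - (1 - p) ^ n) 1 e = e := by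
    intro n
    induction n with
    | zero => simp [A.proj0 1 one_mem e he.1]
    | succ n ih =>
      have := A.expand hp' (hn n) he.1 one_mem
      rw [ih, hfe] at this
      refine Eq.trans ?_ this.symm
      congr 1; ring
  have : (1:ℝ) ≤ e := by
    refine lc' hLC he.1 one_mem he1.le fun r hr => ?_
    obtain ⟨n, hn'⟩ := exists_pow_lt_of_lt_one (show 0 < 1 - r by linarith [hr.2])
      (show 1 - p < 1 by linarith [hp.1])
    have := seg_mono hMO (hn n) ⟨hr.1.le, hr.2.le⟩ he.1 one_mem he1.le (by linarith)
    rwa [hit n] at this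
  linarith

lemma top_strict (hMO : A.MO) (hLC : A.LC) {e : ℝ} (he : e ∈ A.E) (hmax : ∀ c ∈ A.E, c ≤ e)
    (he1 : e < 1) {p q : ℝ} (hp : p ∈ Icc (0:ℝ) 1) (hq : q ∈ Icc (0:ℝ) 1) (hqp : q < p) :
    A.op q 1 e < A.op p 1 e := by
  refine lt_of_le_of_ne (seg_mono hMO hp hq he.1 one_mem he1.le hqp.le) fun heq => ?_
  have h0 : 0 < p := hq.1.trans_lt hqp
  have hs : q / p ∈ Icc (0:ℝ) 1 := ⟨div_nonneg hq.1 h0.le, by rw [div_le_one h0]; exact hqp.le⟩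
  have hs1 : q / p < 1 := by rwa [div_lt_one h0]
  have hz := A.mem p hp 1 one_mem e he.1
  have hpos := top_pos hMO hLC he he1 ⟨h0, hp.2⟩
  set z := A.op p 1 e with hzdef
  have hzs : A.op (q / p) z e = z := by
    rw [hzdef, A.contract hs hp he.1 one_mem, mul_div_cancel₀ _ h0.ne', heq]
  have hpw : ∀ n : ℕ, (q / p) ^ n ∈ Icc (0:ℝ) 1 := fun n =>
    ⟨pow_nonneg hs.1 n, pow_le_one₀ hs.1 hs.2⟩
  have hit : ∀ n : ℕ, A.op ((q / p) ^ n) z e = z := by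
    intro n
    induction n with
    | zero => simp [A.proj1 z hz e he.1]
    | succ n ih =>
      rw [pow_succ, ← A.contract hs (hpw n) he.1 hz, ih, hzs]
  refine hpos.ne' (top_eat hMO hLC he hmax hz hpos.le fun t ht => ?_)
  obtain ⟨n, hn⟩ := exists_pow_lt_of_lt_one ht.1 hs1
  have := seg_mono hMO ⟨ht.1.le, ht.2.le⟩ (hpw n) he.1 hz hpos.le hn.le
  rwa [hit n] at this

lemma top_zero (hMO : A.MO) (hUC : A.UC) (hLC : A.LC) {e : ℝ} (he : e ∈ A.E)
    (hmax : ∀ c ∈ A.E, c ≤ e) (he1 : e < 1) {ε : ℝ} (hε : 0 < ε) :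
    ∃ p ∈ Ioo (0:ℝ) 1, A.op p 1 e < e + ε := by
  set S := (fun p => A.op p 1 e) '' Ioo (0:ℝ) 1 with hS
  have hhalf : (1/2 : ℝ) ∈ Ioo (0:ℝ) 1 := by norm_num
  have hne : S.Nonempty := ⟨_, 1/2, hhalf, rfl⟩
  have hlow : ∀ c ∈ S, e ≤ c := by
    rintro _ ⟨p, hp, rfl⟩
    exact (top_pos hMO hLC he he1 ⟨hp.1, hp.2.le⟩).le
  have hbd : BddBelow S := ⟨e, hlow⟩
  have hev : e ≤ sInf S := le_csInf hne hlow
  have hv1 : sInf S < 1 := by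
    refine (csInf_le hbd ⟨1/2, hhalf, rfl⟩).trans_lt ?_
    have := top_strict hMO hLC he hmax he1 one_mem ⟨hhalf.1.le, hhalf.2.le⟩ hhalf.2
    rwa [A.proj1 1 one_mem e he.1] at this
  have hvI : sInf S ∈ Icc (0:ℝ) 1 := ⟨he.1.1.trans hev, hv1.le⟩
  have hve : sInf S = e := by
    refine top_eat hMO hLC he hmax hvI hev fun t ht => ?_
    have ht' : t ∈ Icc (0:ℝ) 1 := ⟨ht.1.le, ht.2.le⟩
    refine uc' hUC ⟨hvI.1, hv1⟩ ⟨he.1.1, he1⟩ ht fun δ hδ h1 h2 => ?_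
    obtain ⟨_, ⟨p, hp, rfl⟩, hlt⟩ := exists_lt_of_csInf_lt hne (lt_add_of_pos_right (sInf S) hδ)
    have hp' : p ∈ Icc (0:ℝ) 1 := ⟨hp.1.le, hp.2.le⟩
    have h3 := mo2 hMO ht' (A.mem p hp' 1 one_mem e he.1) ⟨by linarith [hvI.1], h1⟩ he.1
      (y' := e + δ) ⟨by linarith [he.1.1], h2⟩ hlt.le (by linarith)
    rw [A.contract ht' hp' he.1 one_mem] at h3
    refine le_trans (csInf_le hbd ⟨p * t, ⟨mul_pos hp.1 ht.1, ?_⟩, rfl⟩) h3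
    nlinarith [hp.1, hp.2, ht.1, ht.2]
  obtain ⟨_, ⟨p, hp, rfl⟩, hlt⟩ := exists_lt_of_csInf_lt hne (show sInf S < e + ε by linarith)
  exact ⟨p, hp, hlt⟩

lemma top_surj (hMO : A.MO) (hUC : A.UC) (hLC : A.LC) {e : ℝ} (he : e ∈ A.E)
    (hmax : ∀ c ∈ A.E, c ≤ e) (he1 : e < 1) {z : ℝ} (hz : z ∈ Icc e 1) :
    ∃ p ∈ Icc (0:ℝ) 1, A.op p 1 e = z := by
  set S := {p | p ∈ Icc (0:ℝ) 1 ∧ A.op p 1 e ≤ z} with hS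
  have h0S : (0:ℝ) ∈ S := ⟨zero_mem, by rw [A.proj0 1 one_mem e he.1]; exact hz.1⟩
  have hne : S.Nonempty := ⟨0, h0S⟩
  have hbd : BddAbove S := ⟨1, fun p hp => hp.1.2⟩
  have hP : sSup S ∈ Icc (0:ℝ) 1 := ⟨le_csSup hbd h0S, csSup_le hne fun p hp => hp.1.2⟩
  have hgt : ∀ p ∈ Icc (0:ℝ) 1, sSup S < p → z < A.op p 1 e := by
    intro p hp hlt
    by_contra hcon
    exact absurd (le_csSup hbd ⟨hp, not_lt.1 hcon⟩) (not_le.2 hlt)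
  have hlt : ∀ p ∈ Icc (0:ℝ) 1, p < sSup S → A.op p 1 e ≤ z := by
    intro p hp hlt
    obtain ⟨q, hq, hpq⟩ := exists_lt_of_lt_csSup hne hlt
    exact (seg_mono hMO hq.1 hp he.1 one_mem he1.le hpq.le).trans hq.2
  set P := sSup S with hPdef
  have hfP := A.mem P hP 1 one_mem e he.1
  refine ⟨P, hP, le_antisymm ?_ ?_⟩
  · rcases eq_or_lt_of_le hP.1 with h0 | h0
    · rw [← h0, A.proj0 1 one_mem e he.1]; exact hz.1
    · refine lc' hLC he.1 hfP (le_op hMO hP one_mem he.1 he.1 he1.le le_rfl) fun r hr => ?_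
      have hr' : r ∈ Icc (0:ℝ) 1 := ⟨hr.1.le, hr.2.le⟩
      rw [A.contract hr' hP he.1 one_mem]
      refine hlt _ ⟨mul_nonneg hP.1 hr'.1, mul_le_one₀ hP.2 hr'.1 hr'.2⟩ ?_
      nlinarith [hr.2]
  · rcases eq_or_lt_of_le hP.2 with h1 | h1
    · rw [h1, A.proj1 1 one_mem e he.1]; exact hz.2
    rcases eq_or_lt_of_le hP.1 with h0 | h0
    · rw [← h0, A.proj0 1 one_mem e he.1]
      by_contra hcon
      obtain ⟨p, hp, hpe⟩ := top_zero hMO hUC hLC he hmax he1 (show 0 < z - e by linarith)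
      have := hgt p ⟨hp.1.le, hp.2.le⟩ (by rw [← h0]; exact hp.1)
      linarith
    · obtain ⟨p1, hP1, hp11⟩ := exists_between h1
      have hp1 : p1 ∈ Icc (0:ℝ) 1 := ⟨by linarith, hp11.le⟩
      have hp1pos : 0 < p1 := h0.trans hP1
      have hq : P / p1 ∈ Ioo (0:ℝ) 1 := ⟨div_pos h0 hp1pos, by rwa [div_lt_one hp1pos]⟩
      have hq' : P / p1 ∈ Icc (0:ℝ) 1 := ⟨hq.1.le, hq.2.le⟩
      have hf1 := A.mem p1 hp1 1 one_mem e he.1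
      have hf1lt : A.op p1 1 e < 1 := by
        have := top_strict hMO hLC he hmax he1 one_mem hp1 hp11
        rwa [A.proj1 1 one_mem e he.1] at this
      have heq : A.op (P / p1) (A.op p1 1 e) e = A.op P 1 e := by
        rw [A.contract hq' hp1 he.1 one_mem, mul_div_cancel₀ _ hp1pos.ne']
      rw [← heq]
      refine uc' hUC ⟨hf1.1, hf1lt⟩ ⟨he.1.1, he1⟩ hq fun ε hε h3 h4 => ?_
      obtain ⟨p2, hp2, hp2e⟩ := top_zero hMO hUC hLC he hmax he1 hε
      have hp2' : p2 ∈ Icc (0:ℝ) 1 := ⟨hp2.1.le, hp2.2.le⟩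
      have h5 := mo2 hMO hq' hf1 (x' := A.op p1 1 e + ε) ⟨by linarith [hf1.1], h3⟩
        (A.mem p2 hp2' 1 one_mem e he.1)
        (y' := e + ε) ⟨by linarith [he.1.1], h4⟩ (by linarith) hp2e.le
      refine le_trans ?_ h5
      rw [A.seg hq' hp1 hp2' he.1 one_mem]
      refine (hgt _ (comb_mem hq' hp1 hp2') ?_).le
      rw [div_mul_cancel₀ _ hp1pos.ne']
      have := mul_pos (sub_pos.2 hq.2) hp2.1
      linarith

lemma coord_top (hMO : A.MO) (hUC : A.UC) (hLC : A.LC) {e : ℝ} (he : e ∈ A.E)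
    (hmax : ∀ c ∈ A.E, c ≤ e) (he1 : e < 1) : A.Coord e (Icc 0 1) := by
  refine ⟨fun p => A.op p 1 e, ⟨?_, ?_, ?_⟩, A.proj0 1 one_mem e he.1, zero_mem, ?_⟩
  · intro p hp
    exact ⟨A.mem p hp 1 one_mem e he.1, le_op hMO hp one_mem he.1 he.1 he1.le le_rfl,
      fun c hc _ => hmax c hc⟩
  · have : StrictMonoOn (fun p => A.op p 1 e) (Icc 0 1) := fun q hq p hp hqp =>
      top_strict hMO hLC he hmax he1 hp hq hqp
    exact this.injOn
  · intro z hz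
    exact top_surj hMO hUC hLC he hmax he1 ⟨hz.2.1, hz.1.2⟩
  · intro p hp s hs t ht
    have hp' : p ∈ Icc (0:ℝ) 1 := ⟨hp.1.le, hp.2.le⟩
    exact ⟨comb_mem hp' hs ht, (A.seg hp' hs ht he.1 one_mem).symm⟩

lemma coord_single {a : ℝ} (ha : a ∈ A.E) (hP : A.P a = {a}) : A.Coord a {0} := by
  refine ⟨fun _ => a, ?_, rfl, rfl, ?_⟩
  · rw [hP]; simp
  · rintro p hp s rfl t rfl
    exact ⟨by simp, (A.idem p hp a ha.1).symm⟩

lemma P_delta {a b : ℝ} (h : A.Delta a b) : A.P a = Ico a b := by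
  obtain ⟨ha, hb, hab, hemp⟩ := h
  ext y
  constructor
  · rintro ⟨hy, hay, hc⟩
    refine ⟨hay, ?_⟩
    by_contra hcon
    exact absurd (hc b hb (not_lt.1 hcon)) (not_le.2 hab)
  · rintro ⟨hay, hyb⟩
    refine ⟨⟨ha.1.1.trans hay, hyb.le.trans hb.1.2⟩, hay, fun c hc hcy => ?_⟩
    by_contra hcon
    have : c ∈ Ioo a b ∩ A.E := ⟨⟨not_le.1 hcon, hcy.trans_lt hyb⟩, hc⟩
    rw [hemp] at this; exact this

lemma P_top {a : ℝ} (ha : a ∈ A.E) (hmax : ∀ c ∈ A.E, c ≤ a) : A.P a = Icc a 1 := by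
  ext y
  constructor
  · rintro ⟨hy, hay, hc⟩; exact ⟨hay, hy.2⟩
  · rintro ⟨hay, hy1⟩
    exact ⟨⟨ha.1.1.trans hay, hy1⟩, hay, fun c hc _ => hmax c hc⟩

lemma P_none (hMO : A.MO) (hUC : A.UC) {a : ℝ} (ha : a ∈ A.E) (hno : ∀ b, ¬ A.Delta a b)
    (hmax : ¬ ∀ c ∈ A.E, c ≤ a) : A.P a = {a} := by
  push Not at hmax
  obtain ⟨c, hc, hac⟩ := hmax
  ext y
  constructor
  · rintro ⟨hy, hay, hall⟩
    by_contra hne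
    have hlt : a < y := lt_of_le_of_ne hay fun h => hne h.symm
    have hyc : y ≤ c := by
      by_contra hcon
      exact absurd (hall c hc (not_le.1 hcon).le) (not_le.2 hac)
    obtain ⟨b, hb, hyb, hleast⟩ := exists_least hMO hUC hc hyc
    refine hno b ⟨ha, hb, hlt.trans_le hyb, ?_⟩
    ext d
    simp only [mem_inter_iff, mem_Ioo, mem_empty_iff_false, iff_false, not_and]
    rintro ⟨h1, h2⟩ hd
    rcases le_total d y with h | h
    · exact absurd (hall d hd h) (not_le.2 h1)
    · exact absurd (hleast d hd h) (not_le.2 h2)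
  · rintro rfl
    exact ⟨ha.1, le_rfl, fun _ _ h => h⟩

lemma tau_zero {τ : ENNReal} (hτ : τ ∈ ({1, ⊤} : Set ENNReal)) : (0:ℝ) ∈ tauSet τ := by
  rcases hτ with h | h
  · subst h; simp [tauSet]
  · rw [mem_singleton_iff] at h; subst h; simp [tauSet]

lemma tau_comb {τ : ENNReal} {p s t : ℝ} (hp : p ∈ Ioo (0:ℝ) 1)
    (hs : s ∈ tauSet τ) (ht : t ∈ tauSet τ) : p * s + (1 - p) * t ∈ tauSet τ := by
  refine ⟨by nlinarith [hs.1, ht.1, hp.1, hp.2, mul_nonneg hp.1.le hs.1,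
    mul_nonneg (sub_nonneg.2 hp.2.le) ht.1], ?_⟩
  refine lt_of_le_of_lt ?_ (max_lt hs.2 ht.2)
  rw [← ENNReal.ofReal_max]
  apply ENNReal.ofReal_le_ofReal
  nlinarith [mul_le_mul_of_nonneg_left (le_max_left s t) hp.1.le,
    mul_le_mul_of_nonneg_left (le_max_right s t) (sub_nonneg.2 hp.2.le)]

lemma tau_half {τ : ENNReal} {s : ℝ} (hs : s ∈ tauSet τ) : ∃ t ∈ tauSet τ, s < t := by
  obtain ⟨h0, h⟩ := hs
  by_cases hτ : τ = ⊤
  · subst hτ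
    exact ⟨s + 1, ⟨by linarith, by simp⟩, by linarith⟩
  · obtain ⟨t, h1, h2⟩ := exists_between ((ENNReal.ofReal_lt_iff_lt_toReal h0 hτ).1 h)
    exact ⟨t, ⟨by linarith, (ENNReal.ofReal_lt_iff_lt_toReal (by linarith) hτ).2 h2⟩, h1⟩

lemma coord_delta (hMO : A.MO) {a b : ℝ} {τ : ENNReal} {Φ : ℝ → ℝ} (hd : A.Delta a b)
    (hτ : τ ∈ ({1, ⊤} : Set ENNReal)) (hΦ : A.IsTauIso a b τ Φ) : A.Coord a (tauSet τ) := by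
  have hP := P_delta hd
  obtain ⟨hbij, hhom⟩ := hΦ
  refine ⟨Φ, hP ▸ hbij, ?_, tau_zero hτ, fun p hp s hs t ht =>
    ⟨tau_comb hp hs ht, hhom p hp s hs t ht⟩⟩
  obtain ⟨s, hs, hsa⟩ := hbij.surjOn ⟨le_rfl, hd.2.2.1⟩
  obtain ⟨t, ht, hst⟩ := tau_half hs
  have h0 := tau_zero hτ
  have hin : ∀ u ∈ tauSet τ, a ≤ Φ u ∧ Φ u ∈ Icc (0:ℝ) 1 := fun u hu => by
    have h1 : Φ u ∈ A.P a := hP ▸ hbij.mapsTo hu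
    exact ⟨h1.2.1, h1.1⟩
  rcases eq_or_lt_of_le hs.1 with h | h
  · rw [← h] at hsa; exact hsa
  exfalso
  -- `s` is a proper combination of `t` and `0`
  have htpos : 0 < t := h.trans hst
  have hp : s / t ∈ Ioo (0:ℝ) 1 := ⟨div_pos h htpos, by rwa [div_lt_one htpos]⟩
  have e1 := hhom (s / t) hp t ht 0 h0
  rw [div_mul_cancel₀ _ htpos.ne', mul_zero, add_zero, hsa] at e1
  have e2 := hhom (s / t) hp t ht s hs
  have hp' : s / t ∈ Icc (0:ℝ) 1 := ⟨hp.1.le, hp.2.le⟩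
  have hle : A.op (s / t) (Φ t) (Φ s) ≤ A.op (s / t) (Φ t) (Φ 0) :=
    mo2 hMO hp' (hin t ht).2 (hin t ht).2 (hin s hs).2 (hin 0 h0).2 le_rfl
      (hsa ▸ (hin 0 h0).1)
  rw [← e1, ← e2] at hle
  have hc := tau_comb hp ht hs
  have : Φ (s / t * t + (1 - s / t) * s) = Φ s :=
    le_antisymm (hsa.symm ▸ hle) (hsa.symm ▸ (hin _ hc).1)
  have h2 := hbij.injOn hc hs this
  rw [div_mul_cancel₀ _ htpos.ne'] at h2
  have := mul_pos (sub_pos.2 hp.2) h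
  linarith

lemma coord_exists (hMO : A.MO) (hUC : A.UC) (hLC : A.LC) {τ : ℝ → ℝ → ENNReal}
    (hτ : ∀ a b, A.Delta a b →
      τ a b ∈ ({1, ⊤} : Set ENNReal) ∧ ∃ Φ : ℝ → ℝ, A.IsTauIso a b (τ a b) Φ)
    {a : ℝ} (ha : a ∈ A.E) : ∃ S, A.Coord a S := by
  by_cases h1 : ∃ b, A.Delta a b
  · obtain ⟨b, hb⟩ := h1
    obtain ⟨h2, Φ, hΦ⟩ := hτ a b hb
    exact ⟨_, coord_delta hMO hb h2 hΦ⟩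
  by_cases h2 : ∀ c ∈ A.E, c ≤ a
  · rcases eq_or_lt_of_le ha.1.2 with h | h
    · refine ⟨_, coord_single ha ?_⟩
      rw [P_top ha h2, h, Icc_self]
    · exact ⟨_, coord_top hMO hUC hLC ha h2 h⟩
  · exact ⟨_, coord_single ha (P_none hMO hUC ha (not_exists.1 h1) h2)⟩

lemma coord_glue {A A' : UCA} {a a' : ℝ} {S : Set ℝ} (h : A.Coord a S) (h' : A'.Coord a' S) :
    ∃ g : ℝ → ℝ, BijOn g (A.P a) (A'.P a') ∧ g a = a' ∧
      ∀ p ∈ Ioo (0:ℝ) 1, ∀ x ∈ A.P a, ∀ y ∈ A.P a, g (A.op p x y) = A'.op p (g x) (g y) := by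
  obtain ⟨f, hf, hf0, h0, hfh⟩ := h
  obtain ⟨f', hf', hf0', -, hfh'⟩ := h'
  have hinv := hf.invOn_invFunOn
  have hb := (bijOn_comm hinv).2 hf
  refine ⟨f' ∘ Function.invFunOn f S, hf'.comp hb, ?_, ?_⟩
  · rw [← hf0, Function.comp, hinv.1 h0, hf0']
  · intro p hp x hx y hy
    obtain ⟨s, hs, rfl⟩ := hf.surjOn hx
    obtain ⟨t, ht, rfl⟩ := hf.surjOn hy
    simp only [Function.comp]
    rw [← (hfh p hp s hs t ht).2, hinv.1 (hfh p hp s hs t ht).1, hinv.1 hs, hinv.1 ht,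
      (hfh' p hp s hs t ht).2]

/-- Eating a strictly smaller element forces membership in `E`. -/
lemma eats_mem (hMO : A.MO) (hLC : A.LC) (hco : ∀ a ∈ A.E, ∃ S, A.Coord a S) {x y : ℝ}
    (hx : x ∈ Icc (0:ℝ) 1) (hy : y ∈ Icc (0:ℝ) 1) (hxy : x < y) (h : A.Eats y x) : y ∈ A.E := by
  obtain ⟨a, ha, hay, hgr⟩ := exists_greatest hMO hy
  by_contra hyE
  have hay' : a < y := lt_of_le_of_ne hay fun h => hyE (h ▸ ha)
  have hhalf : (1/2 : ℝ) ∈ Ioo (0:ℝ) 1 := by norm_num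
  have hm : max x a < y := max_lt hxy hay'
  have hmP : max x a ∈ A.P a := ⟨⟨hx.1.trans (le_max_left _ _), hm.le.trans hy.2⟩,
    le_max_right _ _, fun c hc hcm => hgr c hc (hcm.trans hm.le)⟩
  have heat : A.op (1/2) y (max x a) = y := by
    rcases le_total x a with hxa | hxa
    · rw [max_eq_right hxa, ← key hMO hLC ha hx hy hxa hay hhalf]
      exact h _ ⟨hhalf.1, hhalf.2.le⟩
    · rw [max_eq_left hxa]
      exact h _ ⟨hhalf.1, hhalf.2.le⟩
  obtain ⟨S, f, hf, -, -, hh⟩ := hco a ha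
  obtain ⟨s, hs, hfs⟩ := hf.surjOn (⟨hy, hay, hgr⟩ : y ∈ A.P a)
  obtain ⟨t, ht, hft⟩ := hf.surjOn hmP
  obtain ⟨h1, h2⟩ := hh _ hhalf s hs t ht
  rw [hfs, hft, heat, ← hfs] at h2
  have h3 := hf.injOn h1 hs h2
  have : s = t := by linarith
  rw [this, hft] at hfs
  linarith

lemma eats_le (hLC : A.LC) {x y : ℝ} (hx : x ∈ Icc (0:ℝ) 1) (hy : y ∈ Icc (0:ℝ) 1)
    (h : A.Eats y x) : x ≤ y := by
  by_contra hcon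
  refine hcon (lc' hLC hy hx (not_le.1 hcon).le fun r hr => ?_)
  rw [A.comm r hr x hx y hy, h (1 - r) ⟨by linarith [hr.2], by linarith [hr.1]⟩]

lemma eats_iff (hMO : A.MO) (hLC : A.LC) (hco : ∀ a ∈ A.E, ∃ S, A.Coord a S) {x y : ℝ}
    (hx : x ∈ Icc (0:ℝ) 1) (hy : y ∈ Icc (0:ℝ) 1) :
    (A.Eats y x ∧ x ≠ y) ↔ (y ∈ A.E ∧ x < y) := by
  constructor
  · rintro ⟨h, hne⟩
    have := lt_of_le_of_ne (eats_le hLC hx hy h) hne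
    exact ⟨eats_mem hMO hLC hco hx hy this h, this⟩
  · rintro ⟨h, hlt⟩
    exact ⟨E_eats hMO h hx hlt.le, hlt.ne⟩

lemma sSup_lt_iff (hMO : A.MO) : sSup A.E < 1 ↔ (1:ℝ) ∉ A.E := by
  obtain ⟨a, ha, ha1, hgr⟩ := exists_greatest hMO one_mem
  have : sSup A.E = a := IsGreatest.csSup_eq ⟨ha, fun c hc => hgr c hc hc.1.2⟩
  rw [this]
  constructor
  · intro h h1; exact absurd (hgr 1 h1 le_rfl) (not_le.2 h)
  · intro h; exact lt_of_le_of_ne ha1 fun he => h (he ▸ ha)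

lemma delta_map {A A' : UCA} {φ : ℝ → ℝ} (hφ : BijOn φ A.E A'.E) (hm : StrictMonoOn φ A.E)
    {a b : ℝ} (ha : a ∈ A.E) (hb : b ∈ A.E) : A.Delta a b ↔ A'.Delta (φ a) (φ b) := by
  constructor
  · rintro ⟨-, -, hab, hemp⟩
    refine ⟨hφ.mapsTo ha, hφ.mapsTo hb, hm ha hb hab, ?_⟩
    ext d'
    simp only [mem_inter_iff, mem_Ioo, mem_empty_iff_false, iff_false, not_and]
    rintro ⟨h1, h2⟩ hd'
    obtain ⟨d, hd, rfl⟩ := hφ.surjOn hd'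
    have : d ∈ Ioo a b ∩ A.E := ⟨⟨(hm.lt_iff_lt ha hd).1 h1, (hm.lt_iff_lt hd hb).1 h2⟩, hd⟩
    rw [hemp] at this; exact this
  · rintro ⟨-, -, hab, hemp⟩
    refine ⟨ha, hb, (hm.lt_iff_lt ha hb).1 hab, ?_⟩
    ext d
    simp only [mem_inter_iff, mem_Ioo, mem_empty_iff_false, iff_false, not_and]
    rintro ⟨h1, h2⟩ hd
    have : φ d ∈ Ioo (φ a) (φ b) ∩ A'.E := ⟨⟨hm ha hd h1, hm hd hb h2⟩, hφ.mapsTo hd⟩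
    rw [hemp] at this; exact this

lemma not_both {a b : ℝ} {Ψ₁ Ψ₂ : ℝ → ℝ} (h₁ : A.IsTauIso a b 1 Ψ₁)
    (h₂ : A.IsTauIso a b ⊤ Ψ₂) : False := by
  obtain ⟨hb₁, hh₁⟩ := h₁
  obtain ⟨hb₂, hh₂⟩ := h₂
  have m1 : ∀ t : ℝ, t ∈ tauSet 1 ↔ 0 ≤ t ∧ t < 1 := fun t => by simp [tauSet]
  have m2 : ∀ t : ℝ, t ∈ tauSet ⊤ ↔ 0 ≤ t := fun t => by simp [tauSet]
  have hex : ∀ s, ∃ t, s ∈ tauSet 1 → t ∈ tauSet ⊤ ∧ Ψ₂ t = Ψ₁ s := by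
    intro s
    by_cases hs : s ∈ tauSet 1
    · obtain ⟨t, ht, hts⟩ := hb₂.surjOn (hb₁.mapsTo hs)
      exact ⟨t, fun _ => ⟨ht, hts⟩⟩
    · exact ⟨0, fun h => absurd h hs⟩
  choose f hf using hex
  have hhalf : (1/2 : ℝ) ∈ Ioo (0:ℝ) 1 := by norm_num
  have haff : ∀ s ∈ tauSet 1, ∀ t ∈ tauSet 1,
      f (1/2 * s + (1 - 1/2) * t) = 1/2 * f s + (1 - 1/2) * f t := by
    intro s hs t ht
    have hst := tau_comb hhalf hs ht
    apply hb₂.injOn (hf _ hst).1 (tau_comb hhalf (hf s hs).1 (hf t ht).1)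
    rw [(hf _ hst).2, hh₁ _ hhalf s hs t ht, hh₂ _ hhalf _ (hf s hs).1 _ (hf t ht).1,
      (hf s hs).2, (hf t ht).2]
  have hnn : ∀ s ∈ tauSet 1, 0 ≤ f s := fun s hs => (m2 _).1 (hf s hs).1
  have hpos : ∀ s ∈ tauSet 1, 0 < s → f s ≤ 2 * f (1/2) := by
    intro s hs h0
    have hs' := (m1 s).1 hs
    have h1 : 1 - s ∈ tauSet 1 := (m1 _).2 ⟨by linarith, by linarith⟩
    have := haff s hs (1 - s) h1
    rw [show (1/2 * s + (1 - 1/2) * (1 - s) : ℝ) = 1/2 by ring] at this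
    linarith [hnn _ h1]
  have hh : (1/2 : ℝ) ∈ tauSet 1 := (m1 _).2 (by norm_num)
  have hq : (1/4 : ℝ) ∈ tauSet 1 := (m1 _).2 (by norm_num)
  have h0 : (0 : ℝ) ∈ tauSet 1 := (m1 _).2 (by norm_num)
  have hzero : f 0 ≤ 4 * f (1/2) := by
    have := haff 0 h0 (1/2) hh
    rw [show (1/2 * 0 + (1 - 1/2) * (1/2) : ℝ) = 1/4 by ring] at this
    linarith [hpos _ hq (by norm_num), hnn _ hh]
  have hall : ∀ s ∈ tauSet 1, f s ≤ 4 * f (1/2) := by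
    intro s hs
    rcases eq_or_lt_of_le ((m1 s).1 hs).1 with h | h
    · rw [← h]; exact hzero
    · linarith [hpos s hs h, hnn _ hh]
  have hT : 4 * f (1/2) + 1 ∈ tauSet ⊤ := (m2 _).2 (by linarith [hnn _ hh])
  obtain ⟨s, hs, hsT⟩ := hb₁.surjOn (hb₂.mapsTo hT)
  have := hb₂.injOn (hf s hs).1 hT ((hf s hs).2.trans hsT)
  linarith [hall s hs]

lemma tau_unique {a b : ℝ} {τ₁ τ₂ : ENNReal} {Ψ₁ Ψ₂ : ℝ → ℝ}
    (hτ₁ : τ₁ ∈ ({1, ⊤} : Set ENNReal)) (hτ₂ : τ₂ ∈ ({1, ⊤} : Set ENNReal))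
    (h₁ : A.IsTauIso a b τ₁ Ψ₁) (h₂ : A.IsTauIso a b τ₂ Ψ₂) : τ₁ = τ₂ := by
  simp only [mem_insert_iff, mem_singleton_iff] at hτ₁ hτ₂
  rcases hτ₁ with rfl | rfl <;> rcases hτ₂ with rfl | rfl
  · rfl
  · exact (not_both h₁ h₂).elim
  · exact (not_both h₂ h₁).elim
  · rfl

lemma forward (A A' : UCA)
    (hMO : A.MO) (hUC : A.UC) (hLC : A.LC)
    (hMO' : A'.MO) (hUC' : A'.UC) (hLC' : A'.LC)
    (τ τ' : ℝ → ℝ → ENNReal)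
    (hτ : ∀ a b, A.Delta a b →
      τ a b ∈ ({1, ⊤} : Set ENNReal) ∧ ∃ Φ : ℝ → ℝ, A.IsTauIso a b (τ a b) Φ)
    (hτ' : ∀ a b, A'.Delta a b →
      τ' a b ∈ ({1, ⊤} : Set ENNReal) ∧ ∃ Φ : ℝ → ℝ, A'.IsTauIso a b (τ' a b) Φ)
    (Φ : ℝ → ℝ) (hΦ : BijOn Φ (Icc (0:ℝ) 1) (Icc (0:ℝ) 1))
    (hom : ∀ p ∈ Ioo (0:ℝ) 1, ∀ x ∈ Icc (0:ℝ) 1, ∀ y ∈ Icc (0:ℝ) 1,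
          Φ (A.op p x y) = A'.op p (Φ x) (Φ y)) :
    (∃ φ : ℝ → ℝ, Set.BijOn φ A.E A'.E ∧ StrictMonoOn φ A.E ∧
        ∀ a b, A.Delta a b → τ a b = τ' (φ a) (φ b)) ∧
      (sSup A.E < 1 ↔ sSup A'.E < 1) := by
  have hco : ∀ a ∈ A.E, ∃ S, A.Coord a S := fun a ha => coord_exists hMO hUC hLC hτ ha
  have hco' : ∀ a ∈ A'.E, ∃ S, A'.Coord a S := fun a ha => coord_exists hMO' hUC' hLC' hτ' ha
  have heat : ∀ x ∈ Icc (0:ℝ) 1, ∀ y ∈ Icc (0:ℝ) 1, (A.Eats y x ↔ A'.Eats (Φ y) (Φ x)) := by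
    intro x hx y hy
    constructor
    · intro h t ht
      rcases eq_or_lt_of_le ht.2 with h1 | h1
      · subst h1; exact A'.proj1 _ (hΦ.mapsTo hy) _ (hΦ.mapsTo hx)
      · rw [← hom t ⟨ht.1, h1⟩ y hy x hx, h t ht]
    · intro h t ht
      rcases eq_or_lt_of_le ht.2 with h1 | h1
      · subst h1; exact A.proj1 _ hy _ hx
      · apply hΦ.injOn (A.mem t ⟨ht.1.le, ht.2⟩ y hy x hx) hy
        rw [hom t ⟨ht.1, h1⟩ y hy x hx, h t ht]
  have R : ∀ x ∈ Icc (0:ℝ) 1, ∀ y ∈ Icc (0:ℝ) 1,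
      ((y ∈ A.E ∧ x < y) ↔ (Φ y ∈ A'.E ∧ Φ x < Φ y)) := by
    intro x hx y hy
    rw [← eats_iff hMO hLC hco hx hy,
      ← eats_iff hMO' hLC' hco' (hΦ.mapsTo hx) (hΦ.mapsTo hy), heat x hx y hy,
      ne_eq, ne_eq, hΦ.injOn.eq_iff hx hy]
  have hpos : ∀ y ∈ A.E, y ≠ 0 → Φ y ∈ A'.E := fun y hy h0 =>
    ((R 0 zero_mem y hy.1).1 ⟨hy, lt_of_le_of_ne hy.1.1 h0.symm⟩).1
  have hlt : ∀ x ∈ Icc (0:ℝ) 1, ∀ y ∈ A.E, x < y → Φ x < Φ y := fun x hx y hy h =>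
    ((R x hx y hy.1).1 ⟨hy, h⟩).2
  refine ⟨⟨fun x => if x = 0 then 0 else Φ x, ?_⟩, ?_⟩
  · have hm : StrictMonoOn (fun x => if x = 0 then 0 else Φ x) A.E := by
      intro x hx y hy hxy
      have hy0 : y ≠ 0 := (hx.1.1.trans_lt hxy).ne'
      have h1 := hlt x hx.1 y hy hxy
      simp only [if_neg hy0]
      split_ifs with hx0
      · exact (hΦ.mapsTo hx.1).1.trans_lt h1
      · exact h1
    have hbij : BijOn (fun x => if x = 0 then 0 else Φ x) A.E A'.E := by
      refine ⟨?_, hm.injOn, ?_⟩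
      · intro y hy
        simp only
        split_ifs with h0
        · exact A'.zero_E
        · exact hpos y hy h0
      · intro y' hy'
        by_cases h0 : y' = 0
        · exact ⟨0, A.zero_E, by simp [h0]⟩
        · obtain ⟨y, hy, rfl⟩ := hΦ.surjOn hy'.1
          obtain ⟨x, hx, hx0⟩ := hΦ.surjOn zero_mem
          have := (R x hx y hy).2 ⟨hy', hx0 ▸ lt_of_le_of_ne hy'.1.1 (Ne.symm h0)⟩
          have hy0 : y ≠ 0 := (hx.1.trans_lt this.2).ne'
          exact ⟨y, this.1, by simp [hy0]⟩
    refine ⟨hbij, hm, fun a b hd => ?_⟩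
    have hd' := (delta_map hbij hm hd.1 hd.2.1).1 hd
    obtain ⟨ht, Ψ, hΨ⟩ := hτ a b hd
    obtain ⟨ht', Ψ', hΨ'⟩ := hτ' _ _ hd'
    refine tau_unique (Ψ₁ := Φ ∘ Ψ) ht ht' ⟨?_, ?_⟩ hΨ'
    · refine BijOn.comp ?_ hΨ.1
      have hsub : Ico a b ⊆ Icc 0 1 := fun x hx =>
        ⟨hd.1.1.1.trans hx.1, hx.2.le.trans hd.2.1.1.2⟩
      have hb0 : b ≠ 0 := (hd.1.1.1.trans_lt hd.2.2.1).ne'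
      have hiff : ∀ x ∈ Icc (0:ℝ) 1, (x ∈ Ico a b ↔
          Φ x ∈ Ico (if a = 0 then 0 else Φ a) (if b = 0 then 0 else Φ b)) := by
        intro x hx
        rw [if_neg hb0, mem_Ico, mem_Ico]
        refine and_congr ?_ ?_
        · split_ifs with ha0
          · exact ⟨fun _ => (hΦ.mapsTo hx).1, fun _ => ha0 ▸ hx.1⟩
          · rw [← not_lt, ← not_lt, not_iff_not]
            exact ⟨fun h => hlt x hx a hd.1 h, fun h =>
              ((R x hx a hd.1.1).2 ⟨hpos a hd.1 ha0, h⟩).2⟩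
        · exact ⟨fun h => hlt x hx b hd.2.1 h, fun h =>
              ((R x hx b hd.2.1.1).2 ⟨hpos b hd.2.1 hb0, h⟩).2⟩
      refine ⟨fun x hx => (hiff x (hsub hx)).1 hx, hΦ.injOn.mono hsub, fun y hy => ?_⟩
      have hyI : y ∈ Icc (0:ℝ) 1 := ⟨hd'.1.1.1.trans hy.1, hy.2.le.trans hd'.2.1.1.2⟩
      obtain ⟨x, hx, rfl⟩ := hΦ.surjOn hyI
      exact ⟨x, (hiff x hx).2 hy, rfl⟩
    · intro p hp s hs t ht
      have h1 := hΨ.1.mapsTo hs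
      have h2 := hΨ.1.mapsTo ht
      simp only [Function.comp]
      rw [hΨ.2 p hp s hs t ht]
      exact hom p hp _ ⟨hd.1.1.1.trans h1.1, h1.2.le.trans hd.2.1.1.2⟩ _
        ⟨hd.1.1.1.trans h2.1, h2.2.le.trans hd.2.1.1.2⟩
  · rw [sSup_lt_iff hMO, sSup_lt_iff hMO', not_iff_not]
    constructor
    · intro h1
      obtain ⟨x, hx, hx1⟩ := hΦ.surjOn one_mem
      have h2 := eats_le hLC' (hΦ.mapsTo hx) (hΦ.mapsTo one_mem)
        ((heat x hx 1 one_mem).1 (E_eats hMO h1 hx hx.2))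
      have h3 : Φ 1 = 1 := le_antisymm (hΦ.mapsTo one_mem).2 (hx1 ▸ h2)
      exact h3 ▸ hpos 1 h1 one_ne_zero
    · intro h1
      obtain ⟨x, hx, hx1⟩ := hΦ.surjOn one_mem
      have h2 := eats_le hLC one_mem hx
        ((heat 1 one_mem x hx).2 (hx1.symm ▸ E_eats hMO' h1 (hΦ.mapsTo one_mem)
          (hΦ.mapsTo one_mem).2))
      have h3 : x = 1 := le_antisymm hx.2 h2
      subst h3
      obtain ⟨z, hz, hz0⟩ := hΦ.surjOn zero_mem
      exact ((R z hz 1 one_mem).2 ⟨hx1.symm ▸ h1, by rw [hz0, hx1]; exact one_pos⟩).1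

lemma P_unique {a b y : ℝ} (ha : a ∈ A.E) (hb : b ∈ A.E) (h1 : y ∈ A.P a) (h2 : y ∈ A.P b) :
    a = b :=
  le_antisymm (h2.2.2 a ha h1.2.1) (h1.2.2 b hb h2.2.1)

lemma backward (A A' : UCA)
    (hMO : A.MO) (hUC : A.UC) (hLC : A.LC)
    (hMO' : A'.MO) (hUC' : A'.UC) (hLC' : A'.LC)
    (τ τ' : ℝ → ℝ → ENNReal)
    (hτ : ∀ a b, A.Delta a b →
      τ a b ∈ ({1, ⊤} : Set ENNReal) ∧ ∃ Φ : ℝ → ℝ, A.IsTauIso a b (τ a b) Φ)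
    (hτ' : ∀ a b, A'.Delta a b →
      τ' a b ∈ ({1, ⊤} : Set ENNReal) ∧ ∃ Φ : ℝ → ℝ, A'.IsTauIso a b (τ' a b) Φ)
    (φ : ℝ → ℝ) (hφ : BijOn φ A.E A'.E) (hm : StrictMonoOn φ A.E)
    (hφτ : ∀ a b, A.Delta a b → τ a b = τ' (φ a) (φ b))
    (hsup : sSup A.E < 1 ↔ sSup A'.E < 1) :
    ∃ Φ : ℝ → ℝ, Set.BijOn Φ (Set.Icc (0:ℝ) 1) (Set.Icc (0:ℝ) 1) ∧
        ∀ p ∈ Set.Ioo (0:ℝ) 1, ∀ x ∈ Set.Icc (0:ℝ) 1, ∀ y ∈ Set.Icc (0:ℝ) 1,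
          Φ (A.op p x y) = A'.op p (Φ x) (Φ y) := by
  rw [sSup_lt_iff hMO, sSup_lt_iff hMO', not_iff_not] at hsup
  have hS : ∀ a ∈ A.E, ∃ S, A.Coord a S ∧ A'.Coord (φ a) S := by
    intro a ha
    have ha' := hφ.mapsTo ha
    by_cases h1 : ∃ b, A.Delta a b
    · obtain ⟨b, hb⟩ := h1
      have hb' := (delta_map hφ hm ha hb.2.1).1 hb
      obtain ⟨h2, Ψ, hΨ⟩ := hτ a b hb
      obtain ⟨h2', Ψ', hΨ'⟩ := hτ' _ _ hb'
      refine ⟨_, coord_delta hMO hb h2 hΨ, ?_⟩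
      rw [hφτ a b hb]
      exact coord_delta hMO' hb' h2' hΨ'
    have h1' : ∀ b', ¬ A'.Delta (φ a) b' := by
      intro b' hb'
      obtain ⟨b, hb, rfl⟩ := hφ.surjOn hb'.2.1
      exact h1 ⟨b, (delta_map hφ hm ha hb).2 hb'⟩
    have hmaxiff : (∀ c ∈ A.E, c ≤ a) ↔ (∀ c ∈ A'.E, c ≤ φ a) := by
      constructor
      · intro h c' hc'
        obtain ⟨c, hc, rfl⟩ := hφ.surjOn hc'
        exact (hm.le_iff_le hc ha).2 (h c hc)
      · intro h c hc
        exact (hm.le_iff_le hc ha).1 (h _ (hφ.mapsTo hc))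
    by_cases h2 : ∀ c ∈ A.E, c ≤ a
    · have h2' := hmaxiff.1 h2
      by_cases h1E : (1:ℝ) ∈ A.E
      · have e1 : a = 1 := le_antisymm ha.1.2 (h2 1 h1E)
        have e1' : φ a = 1 := le_antisymm ha'.1.2 (h2' 1 (hsup.1 h1E))
        exact ⟨_, coord_single ha (by rw [P_top ha h2, e1, Icc_self]),
          coord_single ha' (by rw [P_top ha' h2', e1', Icc_self])⟩
      · have h1E' : (1:ℝ) ∉ A'.E := fun h => h1E (hsup.2 h)
        exact ⟨_, coord_top hMO hUC hLC ha h2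
            (lt_of_le_of_ne ha.1.2 fun h => h1E (h ▸ ha)),
          coord_top hMO' hUC' hLC' ha' h2'
            (lt_of_le_of_ne ha'.1.2 fun h => h1E' (h ▸ ha'))⟩
    · exact ⟨_, coord_single ha (P_none hMO hUC ha (not_exists.1 h1) h2),
        coord_single ha' (P_none hMO' hUC' ha' h1' (fun h => h2 (hmaxiff.2 h)))⟩
  have hg : ∀ a, ∃ g : ℝ → ℝ, a ∈ A.E → BijOn g (A.P a) (A'.P (φ a)) ∧ g a = φ a ∧
      ∀ p ∈ Ioo (0:ℝ) 1, ∀ x ∈ A.P a, ∀ y ∈ A.P a, g (A.op p x y) = A'.op p (g x) (g y) := by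
    intro a
    by_cases ha : a ∈ A.E
    · obtain ⟨S, h1, h2⟩ := hS a ha
      obtain ⟨g, hg⟩ := coord_glue h1 h2
      exact ⟨g, fun _ => hg⟩
    · exact ⟨id, fun h => absurd h ha⟩
  choose g hg using hg
  have hα : ∀ y, ∃ a, y ∈ Icc (0:ℝ) 1 → a ∈ A.E ∧ y ∈ A.P a := by
    intro y
    by_cases hy : y ∈ Icc (0:ℝ) 1
    · obtain ⟨a, ha, hay, hgr⟩ := exists_greatest hMO hy
      exact ⟨a, fun _ => ⟨ha, hy, hay, hgr⟩⟩
    · exact ⟨0, fun h => absurd h hy⟩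
  choose α hα using hα
  have hΦ : ∀ a ∈ A.E, ∀ y ∈ A.P a, g (α y) y = g a y := by
    intro a ha y hy
    obtain ⟨h1, h2⟩ := hα y hy.1
    rw [P_unique h1 ha h2 hy]
  have hmem : ∀ y ∈ Icc (0:ℝ) 1, g (α y) y ∈ A'.P (φ (α y)) := fun y hy =>
    (hg _ (hα y hy).1).1.mapsTo (hα y hy).2
  refine ⟨fun y => g (α y) y, ⟨fun y hy => (hmem y hy).1, ?_, ?_⟩, ?_⟩
  · intro x hx y hy hxy
    simp only at hxy
    obtain ⟨hax, hxP⟩ := hα x hx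
    obtain ⟨hay, hyP⟩ := hα y hy
    have h1 := hmem x hx
    rw [hxy] at h1
    have h2 := hφ.injOn hax hay
      (P_unique (hφ.mapsTo hax) (hφ.mapsTo hay) h1 (hmem y hy))
    rw [← h2] at hxy hyP
    exact (hg _ hax).1.injOn hxP hyP hxy
  · intro y' hy'
    obtain ⟨a', ha', hay, hgr⟩ := exists_greatest hMO' hy'
    obtain ⟨a, ha, rfl⟩ := hφ.surjOn ha'
    obtain ⟨y, hy, hyy⟩ := (hg a ha).1.surjOn (⟨hy', hay, hgr⟩ : y' ∈ A'.P (φ a))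
    exact ⟨y, hy.1, by simp only; rw [hΦ a ha y hy, hyy]⟩
  · have main : ∀ p ∈ Ioo (0:ℝ) 1, ∀ y ∈ Icc (0:ℝ) 1, ∀ x ∈ Icc (0:ℝ) 1, x ≤ y →
        g (α (A.op p y x)) (A.op p y x) = A'.op p (g (α y) y) (g (α x) x) := by
      intro p hp y hy x hx hxy
      have hp' : p ∈ Icc (0:ℝ) 1 := ⟨hp.1.le, hp.2.le⟩
      obtain ⟨hb, hyP⟩ := hα y hy
      set b := α y with hbdef
      have hin : ∀ z ∈ A.P b, z ≤ y → A.op p y z ∈ A.P b := by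
        intro z hz hzy
        have hle := op_le hMO hp' hy hz.1 hy le_rfl hzy
        exact ⟨A.mem p hp' y hy z hz.1, le_op hMO hp' hy hz.1 hb.1 hyP.2.1 hz.2.1,
          fun c hc hcz => hyP.2.2 c hc (hcz.trans hle)⟩
      rcases le_or_gt b x with hbx | hxb
      · have hxP : x ∈ A.P b := ⟨hx, hbx, fun c hc hcx => hyP.2.2 c hc (hcx.trans hxy)⟩
        rw [hΦ b hb _ (hin x hxP hxy), hΦ b hb x hxP]
        exact (hg b hb).2.2 p hp y hyP x hxP
      · have hbP : b ∈ A.P b := ⟨hb.1, le_rfl, fun _ _ h => h⟩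
        have hb' := hφ.mapsTo hb
        rw [key hMO hLC hb hx hy hxb.le hyP.2.1 hp, hΦ b hb _ (hin b hbP hyP.2.1),
          (hg b hb).2.2 p hp y hyP b hbP, (hg b hb).2.1]
        have h1 : g (α x) x ≤ φ b := by
          by_contra hcon
          have h2 := (hmem x hx).2.2 (φ b) hb' (not_le.1 hcon).le
          have h3 := (hm.le_iff_le hb (hα x hx).1).1 h2
          linarith [(hα x hx).2.2.1]
        exact (key hMO' hLC' hb' (hmem x hx).1 (hmem y hy).1 h1 (hmem y hy).2.1 hp).symm
    intro p hp x hx y hy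
    simp only
    rcases le_total y x with h | h
    · exact main p hp x hx y hy h
    · rw [A.comm p hp x hx y hy, A'.comm p hp _ (hmem x hx).1 _ (hmem y hy).1]
      exact main (1 - p) ⟨by linarith [hp.2], by linarith [hp.1]⟩ y hy x hx h

end UCA

/-- Theorem 3.8: let `⟨[0,1], ⊕_p⟩` and `⟨[0,1], ⊕'_p⟩` be convex algebras satisfying
(MO), (UC), (LC), and let `τ, τ'` assign to each element of `Δ^⊕` (resp. `Δ^⊕′`) the
corresponding structural constant in `{1, ∞}` (i.e. the unique element of `{1, ∞}` such
that `⟨[a,b), ⊕_p⟩ ≅ ⟨[0, τ_{a,b}), +_p⟩`).  Then the algebras are isomorphic iff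
(i) there is a strictly increasing bijection `φ : E^⊕ → E^⊕′` with
`τ_{a,b} = τ'_{φ(a),φ(b)}` for all `(a,b) ∈ Δ^⊕`, and
(ii) `max E^⊕ < 1 ↔ max E^⊕′ < 1` (the maxima being the suprema of these closed
nonempty sets). -/
theorem stmt_17 (A A' : UCA)
    (hMO : A.MO) (hUC : A.UC) (hLC : A.LC)
    (hMO' : A'.MO) (hUC' : A'.UC) (hLC' : A'.LC)
    (τ τ' : ℝ → ℝ → ENNReal)
    (hτ : ∀ a b, A.Delta a b →
      τ a b ∈ ({1, ⊤} : Set ENNReal) ∧ ∃ Φ : ℝ → ℝ, A.IsTauIso a b (τ a b) Φ)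
    (hτ' : ∀ a b, A'.Delta a b →
      τ' a b ∈ ({1, ⊤} : Set ENNReal) ∧ ∃ Φ : ℝ → ℝ, A'.IsTauIso a b (τ' a b) Φ) :
    (∃ Φ : ℝ → ℝ, Set.BijOn Φ (Set.Icc (0:ℝ) 1) (Set.Icc (0:ℝ) 1) ∧
        ∀ p ∈ Set.Ioo (0:ℝ) 1, ∀ x ∈ Set.Icc (0:ℝ) 1, ∀ y ∈ Set.Icc (0:ℝ) 1,
          Φ (A.op p x y) = A'.op p (Φ x) (Φ y)) ↔
    ((∃ φ : ℝ → ℝ, Set.BijOn φ A.E A'.E ∧ StrictMonoOn φ A.E ∧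
        ∀ a b, A.Delta a b → τ a b = τ' (φ a) (φ b)) ∧
      (sSup A.E < 1 ↔ sSup A'.E < 1)) := by
  constructor
  · rintro ⟨Φ, hΦ, hom⟩
    exact UCA.forward A A' hMO hUC hLC hMO' hUC' hLC' τ τ' hτ hτ' Φ hΦ hom
  · rintro ⟨⟨φ, hφ, hm, hφτ⟩, hsup⟩
    exact UCA.backward A A' hMO hUC hLC hMO' hUC' hLC' τ τ' hτ hτ' φ hφ hm hφτ hsup
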